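/- Let w have minimal length in its conjugacy class in a finite Coxeter group W with longest element w₀. Then for v ∈ W, the equality J(v⁻¹wv) = A(v⁻¹) (the ascent set of v⁻¹) holds if and only if v = w_{J(w)} w₀. -/

import Mathlib

/-- The set `J(w)` of simple reflections occurring in a reduced expression for `w`. -/
def coxSupport {B W : Type*} [Group W] {M : CoxeterMatrix B}
    (cs : CoxeterSystem M W) (w : W) : Set B :=
  {b : B | ∃ ω : List B, cs.IsReduced ω ∧ cs.wordProd ω = w ∧ b ∈ ω}

open Polynomial.Chebyshev in
/-- Two reflections whose roots pair as in the standard geometric representation satisfy the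
braid relation of order `m`. -/
theorem reflection_mul_reflection_pow_eq_one {V : Type*} [AddCommGroup V] [Module ℝ V]
    {x y : V} {f g : Module.Dual ℝ V} (hf : f x = 2) (hg : g y = 2) {m : ℕ} (hm : m ≠ 1)
    (hfy : f y = -2 * Real.cos (Real.pi / m)) (hgx : g x = -2 * Real.cos (Real.pi / m)) :
    (Module.reflection hf * Module.reflection hg) ^ m = 1 := by
  obtain rfl | hm0 := eq_or_ne m 0
  · simp
  obtain rfl | hm2 := eq_or_ne m 2
  · have hfy0 : f y = 0 := by simp [hfy]
    have hgx0 : g x = 0 := by simp [hgx]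
    ext z
    simp only [pow_two, LinearEquiv.mul_apply, Module.reflection_apply, map_sub, map_smul, hf, hg,
      hfy0, hgx0, LinearEquiv.coe_one, id]
    module
  have hm3 : 3 ≤ m := by omega
  have hmR : (0 : ℝ) < m := by positivity
  set θ : ℝ := 2 * (Real.pi / m) with hθ
  have hmθ : m * θ = 2 * Real.pi := by rw [hθ]; field_simp
  have ht : 2 * Real.cos θ = f y * g x - 2 := by
    rw [hfy, hgx, hθ, Real.cos_two_mul]; ring
  have hsin : Real.sin θ ≠ 0 := by
    refine (Real.sin_pos_of_pos_of_lt_pi (by positivity) ?_).ne'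
    have : (3 : ℝ) ≤ m := by exact_mod_cast hm3
    nlinarith [Real.pi_pos]
  ext z
  rw [Module.reflection_mul_reflection_pow_apply hf hg m z _ ht]
  obtain ⟨k, rfl | rfl⟩ := Nat.even_or_odd' m
  · have hS : (S ℝ ((k : ℤ) - 1)).eval (2 * Real.cos θ) = 0 := by
      have h := S_two_mul_real_cos θ ((k : ℤ) - 1)
      have hk : (((k : ℤ) - 1 : ℤ) + 1 : ℝ) * θ = Real.pi := by
        push_cast at hmθ ⊢; linarith
      rw [hk, Real.sin_pi] at h
      exact (mul_eq_zero.mp h).resolve_right hsin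
    have h1 : (((2 * k : ℕ) : ℤ) - 2) / 2 = (k : ℤ) - 1 := by omega
    have h2 : (((2 * k : ℕ) : ℤ) - 1) / 2 = (k : ℤ) - 1 := by omega
    rw [h1, h2, hS]
    simp
  · have hS : (S ℝ (k : ℤ)).eval (2 * Real.cos θ) + (S ℝ ((k : ℤ) - 1)).eval (2 * Real.cos θ)
        = 0 := by
      have h := S_two_mul_real_cos θ (k : ℤ)
      have h' := S_two_mul_real_cos θ ((k : ℤ) - 1)
      have hk : (((k : ℤ) : ℝ) + 1) * θ = 2 * Real.pi - (((k : ℤ) - 1 : ℤ) + 1 : ℝ) * θ := by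
        push_cast at hmθ ⊢; linarith
      rw [hk, Real.sin_two_pi_sub] at h
      refine (mul_eq_zero.mp (?_ : _ * Real.sin θ = 0)).resolve_right hsin
      rw [add_mul, h, h']; ring
    have h1 : (((2 * k + 1 : ℕ) : ℤ) - 2) / 2 = (k : ℤ) - 1 := by omega
    have h2 : (((2 * k + 1 : ℕ) : ℤ) - 1) / 2 = (k : ℤ) := by omega
    have h3 : (((2 * k + 1 : ℕ) : ℤ) - 3) / 2 = (k : ℤ) - 1 := by omega
    have h4 : ((2 * k + 1 : ℕ) : ℤ) / 2 = (k : ℤ) := by omega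
    rw [h1, h2, h3, h4, hS]
    simp

namespace CoxeterSystem

theorem simple_injective {B W : Type*} [Group W] {M : CoxeterMatrix B} (cs : CoxeterSystem M W) :
    Function.Injective cs.simple := by
  classical
  let f (b : B) : Module.Dual ℝ (B →₀ ℝ) :=
    Finsupp.lift ℝ ℝ B fun c ↦ -2 * Real.cos (Real.pi / M b c)
  have hf (b c : B) : f b (Finsupp.single c 1) = -2 * Real.cos (Real.pi / M b c) := by simp [f]
  have hf2 (b : B) : f b (Finsupp.single b 1) = 2 := by simp [hf]
  have hlift : M.IsLiftable fun b ↦ Module.reflection (hf2 b) := fun b c ↦ by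
    obtain rfl | hbc := eq_or_ne b c
    · ext1 z
      simp [LinearEquiv.mul_apply, Module.involutive_reflection (hf2 b) z]
    · exact reflection_mul_reflection_pow_eq_one (hf2 b) (hf2 c) (M.off_diagonal b c hbc) (hf b c)
        (by rw [hf, M.symmetric])
  intro b c hbc
  have h := congrArg (cs.lift ⟨_, hlift⟩) hbc
  rw [cs.lift_apply_simple, cs.lift_apply_simple] at h
  by_contra hne
  have h' := DFunLike.congr_fun (LinearEquiv.congr_fun h (Finsupp.single b 1)) b
  rw [Module.reflection_apply_self, Module.reflection_apply] at h'
  simp [Finsupp.single_eq_of_ne hne] at h'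
  linarith


section Cocycle

variable {B W : Type*} [Group W] {M : CoxeterMatrix B} (cs : CoxeterSystem M W)

open Classical in
/-- The action of a simple reflection on signed elements of `W`: conjugation, with a change of
sign at the simple reflection itself. -/
noncomputable def signedConj (b : B) : Function.End (W × ZMod 2) :=
  fun p ↦ (cs.simple b * p.1 * cs.simple b, p.2 + if p.1 = cs.simple b then 1 else 0)

open Classical in
theorem signedConj_mul_pow_apply (b c : B) (n : ℕ) (t : W) (ε : ZMod 2) :
    ((cs.signedConj b * cs.signedConj c) ^ n) (t, ε) =
      ((cs.simple b * cs.simple c) ^ n * t * (cs.simple c * cs.simple b) ^ n,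
        ε + ∑ k ∈ Finset.range (2 * n),
          if t = (cs.simple c * cs.simple b) ^ k * cs.simple c then 1 else 0) := by
  induction n generalizing t ε with
  | zero =>
    simp only [pow_zero, mul_zero, Finset.range_zero, Finset.sum_empty, one_mul, mul_one, add_zero]
    rfl
  | succ n ih =>
    have hstep : (cs.signedConj b * cs.signedConj c) (t, ε) =
        (cs.simple b * cs.simple c * t * (cs.simple c * cs.simple b),
          ε + (if t = cs.simple c then 1 else 0) +
            if t = cs.simple c * cs.simple b * cs.simple c then 1 else 0) := by
      have h : cs.simple c * t * cs.simple c = cs.simple b ↔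
          t = cs.simple c * cs.simple b * cs.simple c := by
        constructor
        · intro h; rw [← h]; simp [mul_assoc]
        · rintro rfl; simp [mul_assoc]
      change cs.signedConj b (cs.signedConj c (t, ε)) = _
      simp only [mul_assoc] at h
      simp only [signedConj, h, mul_assoc]
    have hiff (k : ℕ) : cs.simple b * cs.simple c * t * (cs.simple c * cs.simple b) =
        (cs.simple c * cs.simple b) ^ k * cs.simple c ↔
        t = (cs.simple c * cs.simple b) ^ (k + 2) * cs.simple c := by
      have h1 : (cs.simple c * cs.simple b) ^ (k + 2) * cs.simple c =
          cs.simple c * cs.simple b * ((cs.simple c * cs.simple b) ^ k * cs.simple c) *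
            (cs.simple b * cs.simple c) := by
        rw [pow_succ, pow_succ']; simp only [mul_assoc]
      rw [h1]
      constructor
      · intro h; rw [← h]; simp [mul_assoc]
      · rintro rfl; simp [mul_assoc]
    rw [pow_succ]
    change ((cs.signedConj b * cs.signedConj c) ^ n)
      ((cs.signedConj b * cs.signedConj c) (t, ε)) = _
    rw [hstep, ih]
    refine Prod.ext ?_ ?_
    · simp only [pow_succ, pow_succ' (cs.simple c * cs.simple b), mul_assoc]
    · simp only [hiff]
      rw [show 2 * (n + 1) = 2 * n + 1 + 1 by ring, Finset.sum_range_succ', Finset.sum_range_succ']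
      simp only [zero_add, pow_zero, one_mul, pow_one]
      ring

theorem isLiftable_signedConj : M.IsLiftable cs.signedConj := by
  classical
  intro b c
  funext ⟨t, ε⟩
  rw [signedConj_mul_pow_apply, cs.simple_mul_simple_pow, cs.simple_mul_simple_pow', two_mul,
    Finset.sum_range_add]
  simp only [pow_add, cs.simple_mul_simple_pow', one_mul, mul_one, CharTwo.add_self_eq_zero,
    add_zero]
  rfl

/-- The action of `W` on signed elements extending `signedConj`. -/
noncomputable def signedConjHom : W →* Function.End (W × ZMod 2) :=
  cs.lift ⟨_, cs.isLiftable_signedConj⟩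

theorem signedConjHom_apply (w t : W) (ε : ZMod 2) :
    cs.signedConjHom w (t, ε) = (w * t * w⁻¹, ε + (cs.signedConjHom w (t, 0)).2) := by
  induction w using cs.simple_induction_left generalizing t ε with
  | one =>
    rw [map_one]
    change (t, ε) = (_, ε + 0)
    simp
  | mul_simple_left w b ih =>
    have h (ε : ZMod 2) : cs.signedConjHom (cs.simple b * w) (t, ε) =
        cs.signedConj b (cs.signedConjHom w (t, ε)) := by
      rw [map_mul, signedConjHom, cs.lift_apply_simple]; rfl
    rw [h, h, ih, ih t 0]
    simp only [signedConj, zero_add, mul_inv_rev, inv_simple, mul_assoc, add_assoc]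

/-- The inversion cocycle: it is `1` exactly at the left inversions `t` of `w`. -/
noncomputable def invCocycle (w t : W) : ZMod 2 := (cs.signedConjHom w⁻¹ (t, 0)).2

theorem invCocycle_mul (x y t : W) :
    cs.invCocycle (x * y) t = cs.invCocycle x t + cs.invCocycle y (x⁻¹ * t * x) := by
  have h : cs.signedConjHom (x * y)⁻¹ (t, 0) =
      cs.signedConjHom y⁻¹ (cs.signedConjHom x⁻¹ (t, 0)) := by
    rw [mul_inv_rev, map_mul]; rfl
  rw [invCocycle, h, signedConjHom_apply cs x⁻¹, signedConjHom_apply cs y⁻¹, inv_inv, zero_add]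
  rfl

theorem invCocycle_one (t : W) : cs.invCocycle 1 t = 0 := by
  rw [invCocycle, inv_one, map_one]; rfl

open Classical in
theorem invCocycle_simple (b : B) (t : W) :
    cs.invCocycle (cs.simple b) t = if t = cs.simple b then 1 else 0 := by
  rw [invCocycle, inv_simple, signedConjHom, cs.lift_apply_simple]
  simp [signedConj]

theorem mem_leftInvSeq_of_invCocycle_ne_zero {ω : List B} {t : W}
    (h : cs.invCocycle (cs.wordProd ω) t ≠ 0) : t ∈ cs.leftInvSeq ω := by
  classical
  induction ω generalizing t with
  | nil => simp [invCocycle_one] at h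
  | cons b ω ih =>
    rw [wordProd_cons, invCocycle_mul, invCocycle_simple, inv_simple] at h
    rw [leftInvSeq, List.mem_cons, List.mem_map]
    by_cases htb : t = cs.simple b
    · exact .inl htb
    · rw [if_neg htb, zero_add] at h
      exact .inr ⟨_, ih h, by simp [mul_assoc]⟩

theorem isLeftInversion_of_invCocycle_ne_zero {w t : W} (h : cs.invCocycle w t ≠ 0) :
    cs.IsLeftInversion w t := by
  obtain ⟨ω, hω, rfl⟩ := cs.exists_isReduced w
  exact cs.isLeftInversion_of_mem_leftInvSeq hω (cs.mem_leftInvSeq_of_invCocycle_ne_zero h)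

theorem invCocycle_self {t : W} (ht : cs.IsReflection t) : cs.invCocycle t t = 1 := by
  classical
  obtain ⟨x, b, rfl⟩ := ht
  have h := cs.invCocycle_mul x x⁻¹ (x * cs.simple b * x⁻¹)
  rw [mul_inv_cancel, invCocycle_one] at h
  rw [invCocycle_mul, invCocycle_mul, invCocycle_simple]
  have h1 : x⁻¹ * (x * cs.simple b * x⁻¹) * x = cs.simple b := by group
  have h2 : (x * cs.simple b)⁻¹ * (x * cs.simple b * x⁻¹) * (x * cs.simple b) = cs.simple b := by
    group
  rw [h1] at h
  rw [h1, h2, if_pos rfl, add_right_comm, ← h, zero_add]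

theorem isLeftInversion_iff_invCocycle {w t : W} :
    cs.IsLeftInversion w t ↔ cs.IsReflection t ∧ cs.invCocycle w t ≠ 0 := by
  refine ⟨fun h ↦ ⟨h.1, fun h0 ↦ ?_⟩, fun h ↦ cs.isLeftInversion_of_invCocycle_ne_zero h.2⟩
  have h1 : cs.invCocycle (t * w) t = 1 := by
    rw [invCocycle_mul, cs.invCocycle_self h.1, inv_mul_cancel, one_mul, h0, add_zero]
  have h2 := (cs.isLeftInversion_of_invCocycle_ne_zero (h1 ▸ one_ne_zero)).2
  rw [← mul_assoc, h.1.mul_self, one_mul] at h2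
  exact lt_asymm h.2 h2

theorem isLeftInversion_mul_iff {x y t : W} :
    cs.IsLeftInversion (x * y) t ↔
      ¬ (cs.IsLeftInversion x t ↔ cs.IsLeftInversion y (x⁻¹ * t * x)) := by
  have hr : cs.IsReflection (x⁻¹ * t * x) ↔ cs.IsReflection t := by
    simpa using cs.isReflection_conj_iff x⁻¹ t
  have key : ∀ a b : ZMod 2, a + b ≠ 0 ↔ ¬ (a ≠ 0 ↔ b ≠ 0) := by decide
  simp only [isLeftInversion_iff_invCocycle, invCocycle_mul, hr]
  have := key (cs.invCocycle x t) (cs.invCocycle y (x⁻¹ * t * x))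
  tauto

theorem not_isLeftInversion_one (t : W) : ¬ cs.IsLeftInversion 1 t := by
  simp [IsLeftInversion]

theorem isLeftInversion_simple_iff {b : B} {t : W} :
    cs.IsLeftInversion (cs.simple b) t ↔ t = cs.simple b := by
  classical
  rw [isLeftInversion_iff_invCocycle, invCocycle_simple]
  constructor
  · rintro ⟨-, h⟩
    by_contra hne
    exact h (if_neg hne)
  · rintro rfl
    exact ⟨cs.isReflection_simple b, by simp⟩

theorem isLeftInversion_inv_conj_iff {x t : W} :
    cs.IsLeftInversion x⁻¹ (x⁻¹ * t * x) ↔ cs.IsLeftInversion x t := by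
  have h := cs.isLeftInversion_mul_iff (x := x) (y := x⁻¹) (t := t)
  rw [mul_inv_cancel] at h
  have := cs.not_isLeftInversion_one t
  tauto

theorem mem_leftInvSeq_iff {ω : List B} (hω : cs.IsReduced ω) {t : W} :
    t ∈ cs.leftInvSeq ω ↔ cs.IsLeftInversion (cs.wordProd ω) t :=
  ⟨cs.isLeftInversion_of_mem_leftInvSeq hω, fun h ↦
    cs.mem_leftInvSeq_of_invCocycle_ne_zero (cs.isLeftInversion_iff_invCocycle.mp h).2⟩

theorem ncard_setOf_isLeftInversion (w : W) : {t | cs.IsLeftInversion w t}.ncard = cs.length w := by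
  classical
  obtain ⟨ω, hω, rfl⟩ := cs.exists_isReduced w
  have h : {t | cs.IsLeftInversion (cs.wordProd ω) t} = ((cs.leftInvSeq ω).toFinset : Set W) := by
    ext t
    simp [cs.mem_leftInvSeq_iff hω]
  rw [h, Set.ncard_coe_finset, List.toFinset_card_of_nodup hω.nodup_leftInvSeq,
    length_leftInvSeq, hω.eq]

theorem finite_setOf_isLeftInversion (w : W) : {t | cs.IsLeftInversion w t}.Finite := by
  obtain ⟨ω, hω, rfl⟩ := cs.exists_isReduced w
  exact (cs.leftInvSeq ω).finite_toSet.subset fun t ht ↦ (cs.mem_leftInvSeq_iff hω).mpr ht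

end Cocycle

section Parabolic

variable {B W : Type*} [Group W] {M : CoxeterMatrix B} (cs : CoxeterSystem M W)

/-- The standard parabolic subgroup generated by the simple reflections in `K`. -/
def parabolic (K : Set B) : Subgroup W := Subgroup.closure (cs.simple '' K)

variable {cs} {K L : Set B}

theorem simple_mem_parabolic {b : B} (hb : b ∈ K) : cs.simple b ∈ cs.parabolic K :=
  Subgroup.subset_closure ⟨b, hb, rfl⟩

theorem parabolic_le_iff {P : Subgroup W} :
    cs.parabolic K ≤ P ↔ ∀ b ∈ K, cs.simple b ∈ P := by
  simp [parabolic, Subgroup.closure_le, Set.subset_def]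

theorem parabolic_univ : cs.parabolic Set.univ = ⊤ := by
  rw [parabolic, Set.image_univ, cs.subgroup_closure_range_simple]

theorem conj_mem_of_mem_parabolic {P : Subgroup W} {g x : W} (hx : x ∈ cs.parabolic K)
    (h : ∀ b ∈ K, g * cs.simple b * g⁻¹ ∈ P) : g * x * g⁻¹ ∈ P :=
  parabolic_le_iff (P := P.comap (MulAut.conj g).toMonoidHom).mpr (by simpa using h) hx

theorem wordProd_mem {P : Subgroup W} {ω : List B} (h : ∀ b ∈ ω, cs.simple b ∈ P) :
    cs.wordProd ω ∈ P :=
  P.list_prod_mem (by simpa using h)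

theorem simple_mem_of_leftInvSeq {P : Subgroup W} {ω : List B} (h : ∀ t ∈ cs.leftInvSeq ω, t ∈ P) :
    ∀ b ∈ ω, cs.simple b ∈ P := by
  induction ω with
  | nil => simp
  | cons c ω ih =>
    rw [leftInvSeq, List.forall_mem_cons] at h
    rw [List.forall_mem_cons]
    refine ⟨h.1, ih fun t ht ↦ ?_⟩
    have h2 : cs.simple c * t * (cs.simple c)⁻¹ ∈ P := h.2 _ (List.mem_map_of_mem ht)
    rwa [P.mul_mem_cancel_right (P.inv_mem h.1), P.mul_mem_cancel_left h.1] at h2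

theorem IsLeftInversion.mem_parabolic {w t : W} (h : cs.IsLeftInversion w t)
    (hw : w ∈ cs.parabolic K) : t ∈ cs.parabolic K := by
  induction hw using Subgroup.closure_induction generalizing t with
  | mem x hx =>
    obtain ⟨b, hb, rfl⟩ := hx
    rw [isLeftInversion_simple_iff] at h
    exact h ▸ simple_mem_parabolic hb
  | one => exact absurd h (cs.not_isLeftInversion_one t)
  | mul x y hx hy ihx ihy =>
    rw [isLeftInversion_mul_iff] at h
    by_cases hxt : cs.IsLeftInversion x t
    · exact ihx hxt
    · have h1 := ihy (t := x⁻¹ * t * x) (by tauto)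
      change x ∈ cs.parabolic K at hx
      rwa [Subgroup.mul_mem_cancel_right _ hx,
        Subgroup.mul_mem_cancel_left _ (Subgroup.inv_mem _ hx)] at h1
  | inv x hx ih =>
    change x ∈ cs.parabolic K at hx
    have h1 := ih (t := x * t * x⁻¹) (by
      rw [← isLeftInversion_inv_conj_iff]; simpa [mul_assoc] using h)
    rwa [Subgroup.mul_mem_cancel_right _ (Subgroup.inv_mem _ hx),
      Subgroup.mul_mem_cancel_left _ hx] at h1

theorem exists_isReduced_subset (ω : List B) :
    ∃ ω' : List B, cs.IsReduced ω' ∧ cs.wordProd ω' = cs.wordProd ω ∧ ω' ⊆ ω := by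
  induction ω with
  | nil => exact ⟨[], by simp [IsReduced], rfl, by simp⟩
  | cons b ω ih =>
    obtain ⟨ω', hred, hprod, hsub⟩ := ih
    rcases cs.length_simple_mul (cs.wordProd ω') b with h | h
    · refine ⟨b :: ω', ?_, by rw [wordProd_cons, wordProd_cons, hprod],
        List.cons_subset_cons b hsub⟩
      rw [IsReduced, wordProd_cons, h, hred.eq, List.length_cons]
    · have hinv : cs.IsLeftInversion (cs.wordProd ω') (cs.simple b) :=
        ⟨cs.isReflection_simple b, by omega⟩
      rw [← cs.mem_leftInvSeq_iff hred] at hinv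
      obtain ⟨j, hj, hjb⟩ := List.mem_iff_getElem.mp hinv
      have hdel := cs.getD_leftInvSeq_mul_wordProd ω' j
      rw [List.getD_eq_getElem _ 1 hj, hjb] at hdel
      rw [length_leftInvSeq] at hj
      refine ⟨ω'.eraseIdx j, ?_, by rw [← hdel, hprod, wordProd_cons],
        fun x hx ↦ List.mem_cons_of_mem b (hsub (List.mem_of_mem_eraseIdx hx))⟩
      have hlen := List.length_eraseIdx_add_one hj
      rw [hred.eq] at h
      rw [IsReduced, ← hdel]
      omega

theorem exists_wordProd_eq_of_mem_parabolic {w : W} (hw : w ∈ cs.parabolic K) :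
    ∃ ω : List B, cs.IsReduced ω ∧ cs.wordProd ω = w ∧ ∀ b ∈ ω, b ∈ K := by
  suffices h : ∃ ω : List B, cs.wordProd ω = w ∧ ∀ b ∈ ω, b ∈ K by
    obtain ⟨ω, rfl, hω⟩ := h
    obtain ⟨ω', hred, hprod, hsub⟩ := exists_isReduced_subset (cs := cs) ω
    exact ⟨ω', hred, hprod, fun b hb ↦ hω b (hsub hb)⟩
  induction hw using Subgroup.closure_induction with
  | mem x hx =>
    obtain ⟨b, hb, rfl⟩ := hx
    exact ⟨[b], by simp, by simpa using hb⟩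
  | one => exact ⟨[], by simp, by simp⟩
  | mul x y _ _ ihx ihy =>
    obtain ⟨ω, rfl, hω⟩ := ihx
    obtain ⟨ω', rfl, hω'⟩ := ihy
    exact ⟨ω ++ ω', cs.wordProd_append ω ω', by
      simpa [or_imp, forall_and] using ⟨hω, hω'⟩⟩
  | inv x _ ih =>
    obtain ⟨ω, rfl, hω⟩ := ih
    exact ⟨ω.reverse, cs.wordProd_reverse ω, by simpa using hω⟩

theorem exists_simple_eq_of_mem_parabolic {w : W} (hw : w ∈ cs.parabolic K)
    (hlen : cs.length w = 1) : ∃ b ∈ K, cs.simple b = w := by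
  obtain ⟨ω, hred, rfl, hω⟩ := exists_wordProd_eq_of_mem_parabolic hw
  rw [hred.eq, List.length_eq_one_iff] at hlen
  obtain ⟨b, rfl⟩ := hlen
  exact ⟨b, hω b (by simp), by simp⟩

theorem simple_mem_parabolic_iff {b : B} : cs.simple b ∈ cs.parabolic K ↔ b ∈ K := by
  refine ⟨fun h ↦ ?_, simple_mem_parabolic⟩
  obtain ⟨c, hc, hcb⟩ := exists_simple_eq_of_mem_parabolic h (cs.length_simple b)
  exact cs.simple_injective hcb ▸ hc

theorem exists_isLeftInversion_simple {w : W} (hw : w ∈ cs.parabolic K) (hne : w ≠ 1) :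
    ∃ b ∈ K, cs.IsLeftInversion w (cs.simple b) := by
  obtain ⟨ω, hred, rfl, hω⟩ := exists_wordProd_eq_of_mem_parabolic hw
  cases ω with
  | nil => simp at hne
  | cons b ω =>
    exact ⟨b, hω b (by simp), (cs.mem_leftInvSeq_iff hred).mp (by simp [leftInvSeq])⟩

theorem mem_parabolic_iff {w : W} : w ∈ cs.parabolic K ↔ coxSupport cs w ⊆ K := by
  constructor
  · rintro hw b ⟨ω, hred, rfl, hb⟩
    exact simple_mem_parabolic_iff.mp (simple_mem_of_leftInvSeq
      (fun t ht ↦ ((cs.mem_leftInvSeq_iff hred).mp ht).mem_parabolic hw) b hb)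
  · intro h
    obtain ⟨ω, hred, rfl⟩ := cs.exists_isReduced w
    exact wordProd_mem fun b hb ↦ simple_mem_parabolic (h ⟨ω, hred, rfl, hb⟩)

theorem mem_parabolic_coxSupport (w : W) : w ∈ cs.parabolic (coxSupport cs w) :=
  mem_parabolic_iff.mpr subset_rfl

theorem not_isLeftInversion_of_min {z t : W}
    (hz : ∀ g ∈ cs.parabolic K, cs.length z ≤ cs.length (g * z)) (ht : t ∈ cs.parabolic K) :
    ¬ cs.IsLeftInversion z t :=
  fun h ↦ (hz t ht).not_gt h.2

theorem length_mul_of_min {z g : W}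
    (hz : ∀ g ∈ cs.parabolic K, cs.length z ≤ cs.length (g * z)) (hg : g ∈ cs.parabolic K) :
    cs.length (g * z) = cs.length g + cs.length z := by
  have hconj {t : W} : g⁻¹ * t * g ∈ cs.parabolic K ↔ t ∈ cs.parabolic K := by
    rw [Subgroup.mul_mem_cancel_right _ hg, Subgroup.mul_mem_cancel_left _ (Subgroup.inv_mem _ hg)]
  have hunion : {t | cs.IsLeftInversion (g * z) t} =
      {t | cs.IsLeftInversion g t} ∪ MulAut.conj g '' {t | cs.IsLeftInversion z t} := by
    ext t
    have himg : t ∈ MulAut.conj g '' {t | cs.IsLeftInversion z t} ↔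
        cs.IsLeftInversion z (g⁻¹ * t * g) := by
      constructor
      · rintro ⟨t, ht, rfl⟩; simpa [mul_assoc] using ht
      · intro h; exact ⟨_, h, by simp [mul_assoc]⟩
    rw [Set.mem_union, himg, Set.mem_ofPred_eq, Set.mem_ofPred_eq, isLeftInversion_mul_iff]
    have : cs.IsLeftInversion g t → ¬ cs.IsLeftInversion z (g⁻¹ * t * g) := fun h ↦
      not_isLeftInversion_of_min hz (hconj.mpr (h.mem_parabolic hg))
    tauto
  have hdisj : Disjoint {t | cs.IsLeftInversion g t}
      (MulAut.conj g '' {t | cs.IsLeftInversion z t}) := by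
    rw [Set.disjoint_left]
    rintro _ h ⟨t, ht, rfl⟩
    refine not_isLeftInversion_of_min hz (hconj.mpr (h.mem_parabolic hg)) ?_
    simpa [mul_assoc] using ht
  rw [← ncard_setOf_isLeftInversion, hunion,
    Set.ncard_union_eq hdisj (cs.finite_setOf_isLeftInversion g)
      ((cs.finite_setOf_isLeftInversion z).image _),
    Set.ncard_image_of_injective _ (MulAut.conj g).injective, ncard_setOf_isLeftInversion,
    ncard_setOf_isLeftInversion]

variable (cs K) in
theorem exists_min_coset (y : W) : ∃ g ∈ cs.parabolic K,
    ∀ h ∈ cs.parabolic K, cs.length (g * y) ≤ cs.length (h * (g * y)) := by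
  obtain ⟨g, hg, hmin⟩ := exists_minimalFor_of_wellFoundedLT (· ∈ cs.parabolic K)
    (fun g ↦ cs.length (g * y)) ⟨1, one_mem _⟩
  refine ⟨g, hg, fun h hh ↦ ?_⟩
  rw [← mul_assoc]
  exact (le_total _ _).elim id (hmin (mul_mem hh hg))

/-- The inversions of an element `w` of minimal length in its conjugacy class lie in every
parabolic subgroup containing `w`. -/
theorem IsLeftInversion.conj_mem_parabolic {w y t : W}
    (hmin : ∀ v : W, cs.length w ≤ cs.length (v⁻¹ * w * v))
    (hy : y * w * y⁻¹ ∈ cs.parabolic K) (ht : cs.IsLeftInversion w t) :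
    y * t * y⁻¹ ∈ cs.parabolic K := by
  obtain ⟨g, hg, hz⟩ := exists_min_coset cs K y
  set z := g * y with hzdef
  have hconj (x : W) : z * x * z⁻¹ ∈ cs.parabolic K ↔ y * x * y⁻¹ ∈ cs.parabolic K := by
    have : z * x * z⁻¹ = g * (y * x * y⁻¹) * g⁻¹ := by rw [hzdef]; group
    rw [this, Subgroup.mul_mem_cancel_right _ (Subgroup.inv_mem _ hg),
      Subgroup.mul_mem_cancel_left _ hg]
  rw [← hconj] at hy ⊢
  set u := z * w * z⁻¹ with hu
  have hw : w = z⁻¹ * (u * z) := by rw [hu]; group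
  have hsub : MulAut.conj z⁻¹ '' {t | cs.IsLeftInversion u t} ⊆ {t | cs.IsLeftInversion w t} := by
    rintro _ ⟨r, hr : cs.IsLeftInversion u r, rfl⟩
    have hrK := hr.mem_parabolic hy
    have h1 := not_isLeftInversion_of_min hz hrK
    rw [← isLeftInversion_inv_conj_iff] at h1
    have h2 := not_isLeftInversion_of_min hz (mul_mem (mul_mem (inv_mem hy) hrK) hy)
    have h3 := cs.isLeftInversion_mul_iff (x := u) (y := z) (t := r)
    have h4 := cs.isLeftInversion_mul_iff (x := z⁻¹) (y := u * z) (t := z⁻¹ * r * z)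
    rw [show z⁻¹⁻¹ * (z⁻¹ * r * z) * z⁻¹ = r by group, ← hw] at h4
    rw [MulAut.conj_apply, inv_inv]
    change cs.IsLeftInversion w _
    tauto
  have heq := Set.eq_of_subset_of_ncard_le hsub (by
    rw [Set.ncard_image_of_injective _ (MulAut.conj z⁻¹).injective, ncard_setOf_isLeftInversion,
      ncard_setOf_isLeftInversion]
    simpa [hu] using hmin z⁻¹) (cs.finite_setOf_isLeftInversion w)
  obtain ⟨r, hr, rfl⟩ := heq.symm ▸ (show t ∈ {t | cs.IsLeftInversion w t} from ht)
  simpa [mul_assoc] using IsLeftInversion.mem_parabolic hr hy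

theorem conj_simple_mem_parabolic {w y : W}
    (hmin : ∀ v : W, cs.length w ≤ cs.length (v⁻¹ * w * v))
    (hy : y * w * y⁻¹ ∈ cs.parabolic K) {b : B} (hb : b ∈ coxSupport cs w) :
    y * cs.simple b * y⁻¹ ∈ cs.parabolic K := by
  obtain ⟨ω, hred, rfl, hb⟩ := hb
  exact simple_mem_of_leftInvSeq (P := (cs.parabolic K).comap (MulAut.conj y).toMonoidHom)
    (fun t ht ↦ ((cs.mem_leftInvSeq_iff hred).mp ht).conj_mem_parabolic hmin hy) b hb

end Parabolic

section Longest

variable {B W : Type*} [Group W] {M : CoxeterMatrix B}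

/-- `m` is an element of maximal length in the standard parabolic subgroup of type `K`. -/
structure IsLongestIn (cs : CoxeterSystem M W) (K : Set B) (m : W) : Prop where
  mem : m ∈ cs.parabolic K
  length_le : ∀ v ∈ cs.parabolic K, cs.length v ≤ cs.length m

variable {cs : CoxeterSystem M W} {K : Set B} {m : W}

theorem IsLongestIn.isLeftInversion_iff (hm : cs.IsLongestIn K m) {t : W}
    (ht : cs.IsReflection t) : cs.IsLeftInversion m t ↔ t ∈ cs.parabolic K :=
  ⟨fun h ↦ h.mem_parabolic hm.mem, fun h ↦
    ⟨ht, (hm.length_le _ (mul_mem h hm.mem)).lt_of_ne (ht.length_mul_right_ne m)⟩⟩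

theorem IsLongestIn.isLeftInversion_mul_iff (hm : cs.IsLongestIn K m) {g t : W}
    (hg : g ∈ cs.parabolic K) :
    cs.IsLeftInversion (g * m) t ↔ cs.IsLeftInversion m t ∧ ¬ cs.IsLeftInversion g t := by
  by_cases ht : cs.IsReflection t
  · have h1 := hm.isLeftInversion_iff ht
    have h2 : cs.IsReflection (g⁻¹ * t * g) := by simpa using ht.conj g⁻¹
    rw [cs.isLeftInversion_mul_iff, hm.isLeftInversion_iff h2,
      Subgroup.mul_mem_cancel_right _ hg, Subgroup.mul_mem_cancel_left _ (inv_mem hg), h1]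
    have : cs.IsLeftInversion g t → t ∈ cs.parabolic K := fun h ↦ h.mem_parabolic hg
    tauto
  · exact ⟨fun h ↦ absurd h.1 ht, fun h ↦ absurd h.1.1 ht⟩

theorem IsLongestIn.length_mul (hm : cs.IsLongestIn K m) {g : W} (hg : g ∈ cs.parabolic K) :
    cs.length (g * m) + cs.length g = cs.length m := by
  have hsub : {t | cs.IsLeftInversion g t} ⊆ {t | cs.IsLeftInversion m t} := fun t ht ↦
    (hm.isLeftInversion_iff ht.1).mpr (ht.mem_parabolic hg)
  have heq : {t | cs.IsLeftInversion (g * m) t} =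
      {t | cs.IsLeftInversion m t} \ {t | cs.IsLeftInversion g t} := by
    ext t
    exact hm.isLeftInversion_mul_iff hg
  rw [← cs.ncard_setOf_isLeftInversion (g * m), heq, ← cs.ncard_setOf_isLeftInversion g,
    ← cs.ncard_setOf_isLeftInversion m]
  exact Set.ncard_sdiff_add_ncard_of_subset hsub (cs.finite_setOf_isLeftInversion m)

theorem IsLongestIn.eq_of_isLeftInversion (hm : cs.IsLongestIn K m) {x : W}
    (hx : x ∈ cs.parabolic K) (h : ∀ b ∈ K, cs.IsLeftInversion x (cs.simple b)) : x = m := by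
  have hg : x * m⁻¹ ∈ cs.parabolic K := mul_mem hx (inv_mem hm.mem)
  by_contra hne
  obtain ⟨b, hb, hinv⟩ := exists_isLeftInversion_simple hg (by rwa [ne_eq, mul_inv_eq_one])
  have := (hm.isLeftInversion_mul_iff (t := cs.simple b) hg).mp (by simpa using h b hb)
  exact this.2 hinv

theorem IsLongestIn.eq (hm : cs.IsLongestIn K m) {x : W} (hx : cs.IsLongestIn K x) : x = m :=
  hm.eq_of_isLeftInversion hx.mem fun b hb ↦
    (hx.isLeftInversion_iff (cs.isReflection_simple b)).mpr (simple_mem_parabolic hb)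

theorem IsLongestIn.inv_eq (hm : cs.IsLongestIn K m) : m⁻¹ = m :=
  hm.eq ⟨inv_mem hm.mem, fun v hv ↦ (hm.length_le v hv).trans (cs.length_inv m).ge⟩

theorem IsLongestIn.mul_self (hm : cs.IsLongestIn K m) : m * m = 1 := by
  nth_rewrite 1 [← hm.inv_eq]
  exact inv_mul_cancel m

theorem IsLongestIn.length_conj (hm : cs.IsLongestIn K m) {g : W} (hg : g ∈ cs.parabolic K) :
    cs.length (m * g * m) = cs.length g := by
  have h1 := hm.length_mul (mul_mem hm.mem hg)
  have h2 := hm.length_mul (inv_mem hg)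
  rw [← cs.length_inv (g⁻¹ * m), mul_inv_rev, inv_inv, hm.inv_eq, cs.length_inv] at h2
  omega

theorem IsLongestIn.exists_conj_simple (hm : cs.IsLongestIn K m) {b : B} (hb : b ∈ K) :
    ∃ c ∈ K, cs.simple c = m * cs.simple b * m := by
  have hbK : cs.simple b ∈ cs.parabolic K := simple_mem_parabolic hb
  exact exists_simple_eq_of_mem_parabolic (mul_mem (mul_mem hm.mem hbK) hm.mem)
    ((hm.length_conj hbK).trans (cs.length_simple b))

theorem mul_conj_cancel {G : Type*} [Group G] {m : G} (hm : m * m = 1) (x : G) :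
    m * (m * x * m) * m = x := by
  rw [show m * (m * x * m) * m = (m * m) * x * (m * m) by group, hm, one_mul, mul_one]

theorem IsLongestIn.mem_coxSupport_conj_iff (hm : cs.IsLongestIn K m) {x : W}
    (hx : x ∈ cs.parabolic K) {b c : B} (hc : cs.simple c = m * cs.simple b * m) :
    c ∈ coxSupport cs (m * x * m) ↔ b ∈ coxSupport cs x := by
  have key {x : W} (hx : x ∈ cs.parabolic K) {b c : B} (hc : cs.simple c = m * cs.simple b * m)
      (h : c ∈ coxSupport cs (m * x * m)) : b ∈ coxSupport cs x := by
    let L : Set B := {c | ∃ b ∈ coxSupport cs x, cs.simple c = m * cs.simple b * m}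
    have hL : m * x * m⁻¹ ∈ cs.parabolic L :=
      conj_mem_of_mem_parabolic (mem_parabolic_coxSupport x) fun b hb ↦ by
        obtain ⟨c, hcK, hc⟩ := hm.exists_conj_simple (mem_parabolic_iff.mp hx hb)
        rw [hm.inv_eq, ← hc]
        exact simple_mem_parabolic ⟨b, hb, hc⟩
    rw [hm.inv_eq, mem_parabolic_iff] at hL
    obtain ⟨b', hb', hcb'⟩ := hL h
    rw [hc, mul_left_inj, mul_right_inj] at hcb'
    exact cs.simple_injective hcb' ▸ hb'
  refine ⟨key hx hc, fun h ↦ ?_⟩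
  refine key (x := m * x * m) (b := c) (c := b) (mul_mem (mul_mem hm.mem hx) hm.mem) ?_ ?_
  · rw [hc, mul_conj_cancel hm.mul_self]
  · rwa [mul_conj_cancel hm.mul_self]

theorem IsLongestIn.coxSupport_conj {x : W} (hm : cs.IsLongestIn (coxSupport cs x) m) :
    coxSupport cs (m * x * m) = coxSupport cs x := by
  have hx := mem_parabolic_coxSupport (cs := cs) x
  have hsub := mem_parabolic_iff.mp (mul_mem (mul_mem hm.mem hx) hm.mem)
  refine hsub.antisymm fun b hb ↦ ?_
  obtain ⟨c, hcK, hc⟩ := hm.exists_conj_simple hb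
  refine (hm.mem_coxSupport_conj_iff hx (b := c) (c := b) ?_).mpr hcK
  rw [hc, mul_conj_cancel hm.mul_self]

theorem exists_isLongestIn [Finite W] (cs : CoxeterSystem M W) (K : Set B) :
    ∃ m, cs.IsLongestIn K m := by
  obtain ⟨m, hm, hmax⟩ := Set.exists_max_image (cs.parabolic K : Set W) cs.length
    (Set.toFinite _) ⟨1, one_mem _⟩
  exact ⟨m, hm, hmax⟩

theorem eq_longest_of_coxSupport_conj_eq [Finite W] {w y : W}
    (hmin : ∀ v : W, cs.length w ≤ cs.length (v⁻¹ * w * v))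
    (hm : cs.IsLongestIn (coxSupport cs w) m)
    (hy : coxSupport cs (y * w * y⁻¹) = {b | cs.IsLeftInversion y (cs.simple b)}) : y = m := by
  set K := coxSupport cs (y * w * y⁻¹) with hK
  have hdesc (b : B) : cs.IsLeftInversion y (cs.simple b) ↔ b ∈ K := by rw [hy]; rfl
  have hu : y * w * y⁻¹ ∈ cs.parabolic K := mem_parabolic_coxSupport _
  obtain ⟨n, hn⟩ := exists_isLongestIn cs K
  obtain ⟨g, hg, hz⟩ := exists_min_coset cs K y
  set z := g * y with hzdef
  have hgn : g⁻¹ = n := hn.eq_of_isLeftInversion (inv_mem hg) fun b hb ↦ by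
    have h1 := (hdesc b).mpr hb
    rw [show y = g⁻¹ * z by rw [hzdef]; group, cs.isLeftInversion_mul_iff] at h1
    have h2 := not_isLeftInversion_of_min hz
      (mul_mem (mul_mem (inv_mem (inv_mem hg)) (simple_mem_parabolic hb)) (inv_mem hg))
    tauto
  have hyz : y = n * z := by rw [hzdef, ← hgn]; group
  have hzw : z * w * z⁻¹ = n * (y * w * y⁻¹) * n := by
    rw [hzdef, show g = n by rw [← hn.inv_eq, ← hgn, inv_inv], mul_inv_rev, hn.inv_eq]
    group
  have hconj {b : B} (hb : b ∈ coxSupport cs w) : ∃ c ∈ K, cs.simple c = z * cs.simple b * z⁻¹ := by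
    have hmem : z * cs.simple b * z⁻¹ ∈ cs.parabolic K := by
      have h1 := conj_simple_mem_parabolic hmin hu hb
      rw [show z * cs.simple b * z⁻¹ = g * (y * cs.simple b * y⁻¹) * g⁻¹ by rw [hzdef]; group]
      exact mul_mem (mul_mem hg h1) (inv_mem hg)
    refine exists_simple_eq_of_mem_parabolic hmem ?_
    have h2 := length_mul_of_min hz hmem
    rw [inv_mul_cancel_right] at h2
    have h3 := cs.length_mul_le z (cs.simple b)
    have h4 : cs.length (z * cs.simple b * z⁻¹) ≠ 0 := fun h0 ↦ by
      rw [cs.length_eq_zero_iff, mul_inv_eq_one, mul_eq_left] at h0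
      simpa [h0] using cs.length_simple b
    rw [cs.length_simple] at h3
    omega
  let L : Set B := {c | ∃ b ∈ coxSupport cs w, cs.simple c = z * cs.simple b * z⁻¹}
  have hKL : K ⊆ L := by
    have h1 : z * w * z⁻¹ ∈ cs.parabolic L :=
      conj_mem_of_mem_parabolic (mem_parabolic_coxSupport w) fun b hb ↦ by
        obtain ⟨c, _, hc⟩ := hconj hb
        exact hc ▸ simple_mem_parabolic ⟨b, hb, hc⟩
    rw [hzw, mem_parabolic_iff, hn.coxSupport_conj] at h1
    exact h1
  have hback {x : W} (hx : x ∈ cs.parabolic K) :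
      z⁻¹ * x * z ∈ cs.parabolic (coxSupport cs w) := by
    have := conj_mem_of_mem_parabolic (P := cs.parabolic (coxSupport cs w)) (g := z⁻¹) hx
      fun c hc ↦ by
        obtain ⟨b, hb, hcb⟩ := hKL hc
        rw [hcb]
        simpa [mul_assoc] using simple_mem_parabolic hb
    rwa [inv_inv] at this
  have hforth {x : W} (hx : x ∈ cs.parabolic (coxSupport cs w)) :
      z * x * z⁻¹ ∈ cs.parabolic K :=
    conj_mem_of_mem_parabolic hx fun b hb ↦ by
      obtain ⟨c, hcK, hc⟩ := hconj hb
      exact hc ▸ simple_mem_parabolic hcK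
  have hzinv : ∀ h ∈ cs.parabolic (coxSupport cs w),
      cs.length z⁻¹ ≤ cs.length (h * z⁻¹) := fun h hh ↦ by
    have h1 := hz _ (hforth (inv_mem hh))
    rw [inv_mul_cancel_right, ← cs.length_inv (z * h⁻¹), mul_inv_rev, inv_inv] at h1
    rwa [cs.length_inv]
  set c := z⁻¹ * n * z with hc
  have hyc : y = z * c := by rw [hyz, hc]; group
  have hlen : cs.length y = cs.length z + cs.length c := by
    have h1 := length_mul_of_min hzinv (inv_mem (hback hn.mem))
    rw [← mul_inv_rev, ← hc, ← hyc, cs.length_inv, cs.length_inv, cs.length_inv] at h1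
    omega
  have hz1 : z = 1 := by
    by_contra hne
    obtain ⟨b, hb⟩ := cs.exists_leftDescent_of_ne_one hne
    have hbz : cs.IsLeftInversion z (cs.simple b) :=
      (cs.isLeftInversion_simple_iff_isLeftDescent z b).mpr hb
    have hby : cs.IsLeftInversion y (cs.simple b) := by
      refine ⟨cs.isReflection_simple b, ?_⟩
      have h1 := cs.length_mul_le (cs.simple b * z) c
      rw [mul_assoc, ← hyc] at h1
      have h2 := hbz.2
      omega
    exact not_isLeftInversion_of_min hz (simple_mem_parabolic ((hdesc b).mp hby)) hbz
  have hKJ : K = coxSupport cs w := by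
    refine Set.Subset.antisymm (fun c hc ↦ ?_) fun b hb ↦ ?_
    · obtain ⟨b, hb, hcb⟩ := hKL hc
      rw [hz1, one_mul, inv_one, mul_one] at hcb
      exact cs.simple_injective hcb ▸ hb
    · obtain ⟨c, hc, hcb⟩ := hconj hb
      rw [hz1, one_mul, inv_one, mul_one] at hcb
      exact cs.simple_injective hcb ▸ hc
  rw [hyz, hz1, mul_one]
  rw [hKJ] at hn
  exact hm.eq hn

/-- An element `w` of minimal length in its conjugacy class is conjugated by `y` to an element
whose support is the left descent set of `y` only for `y` the longest element of the standard
parabolic subgroup supporting `w`. -/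
theorem coxSupport_conj_eq_iff [Finite W] {w y : W}
    (hmin : ∀ v : W, cs.length w ≤ cs.length (v⁻¹ * w * v))
    (hm : cs.IsLongestIn (coxSupport cs w) m) :
    coxSupport cs (y * w * y⁻¹) = {b | cs.IsLeftInversion y (cs.simple b)} ↔ y = m := by
  refine ⟨eq_longest_of_coxSupport_conj_eq hmin hm, ?_⟩
  rintro rfl
  rw [hm.inv_eq, hm.coxSupport_conj]
  ext b
  rw [Set.mem_ofPred_eq, hm.isLeftInversion_iff (cs.isReflection_simple b),
    simple_mem_parabolic_iff]

end Longest

end CoxeterSystem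

/-- For `w` of minimal length in its conjugacy class, `w₀` the longest element of `W`
and `w_{J(w)}` the longest element of `W_{J(w)}`:
`J(v⁻¹ w v) = A(v⁻¹)` if and only if `v = w_{J(w)} w₀`. -/
theorem stmt_8 {B W : Type*} [Group W] [Finite W] {M : CoxeterMatrix B}
    (cs : CoxeterSystem M W) (w : W)
    (hmin : ∀ v : W, cs.length w ≤ cs.length (v⁻¹ * w * v))
    (wJ : W) (hwJmem : wJ ∈ Subgroup.closure (cs.simple '' coxSupport cs w))
    (hwJmax : ∀ v ∈ Subgroup.closure (cs.simple '' coxSupport cs w),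
      cs.length v ≤ cs.length wJ)
    (w₀ : W) (hw₀ : ∀ v : W, cs.length v ≤ cs.length w₀)
    (v : W) :
    coxSupport cs (v⁻¹ * w * v) =
        {b : B | cs.length v⁻¹ < cs.length (cs.simple b * v⁻¹)} ↔ v = wJ * w₀ := by
  have hmem (x : W) : x ∈ cs.parabolic Set.univ := by
    rw [CoxeterSystem.parabolic_univ]; exact Subgroup.mem_top x
  have hlong : cs.IsLongestIn Set.univ w₀ := ⟨hmem w₀, fun v _ ↦ hw₀ v⟩
  have hJ : cs.IsLongestIn (coxSupport cs w) wJ := ⟨hwJmem, hwJmax⟩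
  choose τ hτ using fun b ↦ hlong.exists_conj_simple (Set.mem_univ b)
  have hτs (b : B) : cs.simple (τ b) = w₀ * cs.simple b * w₀ := (hτ b).2
  have hττ (b : B) : τ (τ b) = b := cs.simple_injective <| by
    rw [hτs, hτs, CoxeterSystem.mul_conj_cancel hlong.mul_self]
  have hsupp : coxSupport cs (w₀ * v⁻¹ * w * (w₀ * v⁻¹)⁻¹) =
      τ ⁻¹' coxSupport cs (v⁻¹ * w * v) := by
    ext b
    rw [show w₀ * v⁻¹ * w * (w₀ * v⁻¹)⁻¹ = w₀ * (v⁻¹ * w * v) * w₀ by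
      rw [mul_inv_rev, hlong.inv_eq]; group]
    exact hlong.mem_coxSupport_conj_iff (hmem _)
      (by rw [hτs, CoxeterSystem.mul_conj_cancel hlong.mul_self])
  have hdesc : {b | cs.IsLeftInversion (w₀ * v⁻¹) (cs.simple b)} =
      τ ⁻¹' {b : B | cs.length v⁻¹ < cs.length (cs.simple b * v⁻¹)} := by
    have hlen (x : W) : cs.length (w₀ * x) + cs.length x = cs.length w₀ := by
      have h := hlong.length_mul (hmem x⁻¹)
      rwa [← cs.length_inv (x⁻¹ * w₀), mul_inv_rev, inv_inv, hlong.inv_eq, cs.length_inv] at h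
    ext b
    have h1 : cs.simple b * (w₀ * v⁻¹) = w₀ * (cs.simple (τ b) * v⁻¹) := by
      rw [hτs, show w₀ * (w₀ * cs.simple b * w₀ * v⁻¹) = w₀ * w₀ * (cs.simple b * (w₀ * v⁻¹)) by
        group, hlong.mul_self, one_mul]
    have h2 := hlen v⁻¹
    have h3 := hlen (cs.simple (τ b) * v⁻¹)
    simp only [Set.mem_ofPred_eq, Set.mem_preimage, CoxeterSystem.IsLeftInversion,
      cs.isReflection_simple b, true_and, h1]
    omega
  have hsurj : Function.Surjective τ := fun b ↦ ⟨τ b, hττ b⟩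
  have hcore := CoxeterSystem.coxSupport_conj_eq_iff (y := w₀ * v⁻¹) hmin hJ
  rw [hsupp, hdesc, hsurj.preimage_injective.eq_iff] at hcore
  rw [hcore, mul_inv_eq_iff_eq_mul]
  constructor
  · intro h
    rw [h, ← mul_assoc, hJ.mul_self, one_mul]
  · rintro rfl
    rw [← mul_assoc, hJ.mul_self, one_mul]
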